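/- arXiv:2407.09436 — 7 statements merged into one kernel-verified Lean document; each statement's English description precedes it below -/
import Mathlib

section
/- Let α > 0 and L > 0 be real numbers and define the entire function f(z) = (α² + z²)·sin(Lz) + 2iαz·cos(Lz). If z ∈ ℂ is a root of f with Re(z) > 0, then Im(z) < 0. -/
open Complex

theorem stmt_0 (α L : ℝ) (hα : 0 < α) (hL : 0 < L)
    (f : ℂ → ℂ)
    (hf : f = fun z => ((α : ℂ)^2 + z^2) * Complex.sin (L * z)
        + 2 * Complex.I * (α : ℂ) * z * Complex.cos (L * z))
    (z : ℂ) (hz : f z = 0) (hre : 0 < z.re) :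
    z.im < 0 := by
  by_contra! him
  have key : (α + z) ^ 2 * exp (-(L * z) * I) = (α - z) ^ 2 * exp (L * z * I) := by
    simp only [hf, Complex.sin, Complex.cos] at hz
    have h : I / 2 *
        ((α + z) ^ 2 * exp (-(L * z) * I) - (α - z) ^ 2 * exp (L * z * I)) = 0 := by
      rw [← hz]; ring
    have hI : I / 2 ≠ 0 := by simp
    exact sub_eq_zero.mp ((mul_eq_zero.mp h).resolve_left hI)
  have hnorm := congrArg norm key
  simp only [norm_mul, norm_pow, Complex.norm_exp, Complex.sq_norm, Complex.normSq_apply] at hnorm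
  simp only [add_re, add_im, sub_re, sub_im, mul_re, mul_im, neg_re, neg_im, ofReal_re, ofReal_im,
    I_re, I_im] at hnorm
  have hLi : 0 ≤ z.im * L := by positivity
  have hαz : 0 < α * z.re := by positivity
  have hexp : Real.exp (-(z.im * L)) ≤ Real.exp (z.im * L) := Real.exp_le_exp.mpr (by linarith)
  ring_nf at hnorm
  nlinarith [mul_pos hαz (Real.exp_pos (z.im * L)), mul_pos hαz (Real.exp_pos (-(z.im * L))),
    mul_nonneg (add_nonneg (add_nonneg (sq_nonneg α) (sq_nonneg z.re)) (sq_nonneg z.im)) (sub_nonneg.mpr hexp)]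
end

section
/- Let α > 0, let x_ℓ < x_r be real numbers with L = x_r − x_ℓ, and let λ ∈ ℂ with λ ≠ 0. There exists a twice continuously differentiable function v : [x_ℓ, x_r] → ℂ, not identically zero, satisfying v''(x) = −λ² v(x) on [x_ℓ, x_r] together with the boundary conditions iα v(x_ℓ) + v'(x_ℓ) = 0 and iα v(x_r) − v'(x_r) = 0, if and only if (α² + λ²)·sin(Lλ) + 2iαλ·cos(Lλ) = 0. -/
open Complex Set

lemma hasDerivAt_sin_mul_ofReal_sub (c : ℂ) (a x : ℝ) :
    HasDerivAt (fun t : ℝ => Complex.sin (c * (t - a))) (c * Complex.cos (c * (x - a))) x := by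
  have h : HasDerivAt (fun z : ℂ => c * (z - a)) c (x : ℂ) := by
    simpa using ((hasDerivAt_id (x : ℂ)).sub_const (a : ℂ)).const_mul c
  simpa [mul_comm] using h.csin.comp_ofReal

lemma hasDerivAt_cos_mul_ofReal_sub (c : ℂ) (a x : ℝ) :
    HasDerivAt (fun t : ℝ => Complex.cos (c * (t - a))) (-(c * Complex.sin (c * (x - a)))) x := by
  have h : HasDerivAt (fun z : ℂ => c * (z - a)) c (x : ℂ) := by
    simpa using ((hasDerivAt_id (x : ℂ)).sub_const (a : ℂ)).const_mul c
  simpa [mul_comm] using h.ccos.comp_ofReal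

/-- Solutions of the first-order system `v' = w`, `w' = -c² v` on a compact interval are
determined by their initial values. -/
lemma eq_cos_add_sin_of_hasDerivWithinAt {a b : ℝ} {c : ℂ} {v w : ℝ → ℂ}
    (hv : ∀ x ∈ Icc a b, HasDerivWithinAt v (w x) (Icc a b) x)
    (hw : ∀ x ∈ Icc a b, HasDerivWithinAt w (-c ^ 2 * v x) (Icc a b) x)
    {x : ℝ} (hx : x ∈ Icc a b) :
    c * v x = c * v a * Complex.cos (c * (x - a)) + w a * Complex.sin (c * (x - a)) ∧
      w x = w a * Complex.cos (c * (x - a)) - c * v a * Complex.sin (c * (x - a)) := by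
  have hab : a < b ∨ a = b := (hx.1.trans hx.2).lt_or_eq
  rcases hab with hab | rfl
  swap
  · obtain rfl : x = a := le_antisymm hx.2 hx.1
    simp
  have const (f : ℝ → ℂ) (hf : ∀ y ∈ Icc a b, HasDerivWithinAt f 0 (Icc a b) y) : f x = f a :=
    constant_of_derivWithin_zero (fun y hy => (hf y hy).differentiableWithinAt)
      (fun y hy => (hf y (Ico_subset_Icc_self hy)).derivWithin
        (uniqueDiffOn_Icc hab y (Ico_subset_Icc_self hy))) x hx
  have h₁ := const (fun y => c * v y * Complex.cos (c * (y - a)) - w y * Complex.sin (c * (y - a)))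
    fun y hy => by
      refine ((((hv y hy).const_mul c).fun_mul (hasDerivAt_cos_mul_ofReal_sub c a y).hasDerivWithinAt).fun_sub
        ((hw y hy).fun_mul (hasDerivAt_sin_mul_ofReal_sub c a y).hasDerivWithinAt)).congr_deriv ?_
      ring
  have h₂ := const (fun y => c * v y * Complex.sin (c * (y - a)) + w y * Complex.cos (c * (y - a)))
    fun y hy => by
      refine ((((hv y hy).const_mul c).fun_mul (hasDerivAt_sin_mul_ofReal_sub c a y).hasDerivWithinAt).fun_add
        ((hw y hy).fun_mul (hasDerivAt_cos_mul_ofReal_sub c a y).hasDerivWithinAt)).congr_deriv ?_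
      ring
  simp only [sub_self, mul_zero, Complex.cos_zero, Complex.sin_zero, mul_one, sub_zero,
    zero_add] at h₁ h₂
  have h := Complex.sin_sq_add_cos_sq (c * (x - a))
  constructor
  · linear_combination Complex.cos (c * (x - a)) * h₁ + Complex.sin (c * (x - a)) * h₂
      - c * v x * h
  · linear_combination Complex.cos (c * (x - a)) * h₂ - Complex.sin (c * (x - a)) * h₁
      - w x * h

theorem stmt_2 (α : ℝ) (hα : 0 < α) (xl xr : ℝ) (hx : xl < xr) (L : ℝ) (hL : L = xr - xl)
    (lam : ℂ) (hlam : lam ≠ 0) :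
    (∃ v : ℝ → ℂ,
      ContDiffOn ℝ 2 v (Icc xl xr) ∧
      (∃ x ∈ Icc xl xr, v x ≠ 0) ∧
      (∀ x ∈ Icc xl xr,
        derivWithin (derivWithin v (Icc xl xr)) (Icc xl xr) x = -lam^2 * v x) ∧
      Complex.I * α * v xl + derivWithin v (Icc xl xr) xl = 0 ∧
      Complex.I * α * v xr - derivWithin v (Icc xl xr) xr = 0)
    ↔ ((α : ℂ)^2 + lam^2) * Complex.sin (L * lam)
        + 2 * Complex.I * (α : ℂ) * lam * Complex.cos (L * lam) = 0 := by
  have hU : UniqueDiffOn ℝ (Icc xl xr) := uniqueDiffOn_Icc hx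
  have hl : xl ∈ Icc xl xr := left_mem_Icc.2 hx.le
  have hr : xr ∈ Icc xl xr := right_mem_Icc.2 hx.le
  have hθ : (L : ℂ) * lam = lam * (xr - xl) := by rw [hL]; push_cast; ring
  rw [hθ]
  constructor
  · rintro ⟨v, hv, ⟨x, hxI, hvx⟩, hode, hbl, hbr⟩
    have hv' : ContDiffOn ℝ 1 (derivWithin v (Icc xl xr)) (Icc xl xr) :=
      hv.derivWithin hU (by norm_num)
    have sol := fun y hy => eq_cos_add_sin_of_hasDerivWithinAt (c := lam) (x := y)
      (fun y hy => (hv.differentiableOn (by norm_num) y hy).hasDerivWithinAt)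
      (fun y hy => hode y hy ▸ (hv'.differentiableOn (by norm_num) y hy).hasDerivWithinAt) hy
    have hvl : v xl ≠ 0 := by
      intro h0
      have hw0 : derivWithin v (Icc xl xr) xl = 0 := by simpa [h0] using hbl
      have := (sol x hxI).1
      simp [h0, hw0, hlam, hvx] at this
    obtain ⟨h₁, h₂⟩ := sol xr hr
    refine (mul_eq_zero.1 ?_).resolve_left hvl
    set s := Complex.sin (lam * (xr - xl))
    set k := Complex.cos (lam * (xr - xl))
    linear_combination lam * hbr - I * α * h₁ + lam * h₂ - (I * α * s - lam * k) * hbl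
      + α ^ 2 * v xl * s * I_sq
  · intro h
    set v : ℝ → ℂ := fun x =>
      lam * Complex.cos (lam * (x - xl)) - I * α * Complex.sin (lam * (x - xl)) with hvdef
    set w : ℝ → ℂ := fun x =>
      -lam ^ 2 * Complex.sin (lam * (x - xl)) - I * α * lam * Complex.cos (lam * (x - xl)) with hwdef
    have hv (x : ℝ) : HasDerivAt v (w x) x := by
      refine (((hasDerivAt_cos_mul_ofReal_sub lam xl x).const_mul lam).fun_sub
        ((hasDerivAt_sin_mul_ofReal_sub lam xl x).const_mul (I * α))).congr_deriv ?_
      simp only [hwdef]; ring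
    have hw (x : ℝ) : HasDerivAt w (-lam ^ 2 * v x) x := by
      refine (((hasDerivAt_sin_mul_ofReal_sub lam xl x).const_mul (-lam ^ 2)).fun_sub
        ((hasDerivAt_cos_mul_ofReal_sub lam xl x).const_mul (I * α * lam))).congr_deriv ?_
      simp only [hvdef]; ring
    have hvw : ∀ x ∈ Icc xl xr, derivWithin v (Icc xl xr) x = w x := fun x hx =>
      (hv x).hasDerivWithinAt.derivWithin (hU x hx)
    refine ⟨v, ?_, ⟨xl, hl, by simpa [hvdef] using hlam⟩, fun x hx => ?_, ?_, ?_⟩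
    · have hlin : ContDiff ℝ 2 fun x : ℝ => lam * ((x : ℂ) - xl) :=
        contDiff_const.mul (ofRealCLM.contDiff.sub contDiff_const)
      exact ((contDiff_const.mul (Complex.contDiff_cos.restrict_scalars ℝ |>.comp hlin)).sub (contDiff_const.mul (Complex.contDiff_sin.restrict_scalars ℝ |>.comp hlin))).contDiffOn
    · rw [derivWithin_congr hvw (hvw x hx)]
      exact (hw x).hasDerivWithinAt.derivWithin (hU x hx)
    · rw [hvw xl hl]
      simp [hvdef, hwdef]
    · rw [hvw xr hr]
      simp only [hvdef, hwdef]
      linear_combination h - α ^ 2 * Complex.sin (lam * (xr - xl)) * I_sq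
end

section
/- Let z ∈ ℂ with Im(z) > 0. Then the integral ∫₀^∞ τ^{−1/2} e^{izτ} dτ converges and √(−i/π) · ∫₀^∞ τ^{−1/2} e^{izτ} dτ = 1/√z, where √· denotes the principal branch of the complex square root and √(−i/π) = e^{−iπ/4}/√π. -/
open Complex MeasureTheory Set

/-- Complex powers with a fixed exponent are multiplicative when the arguments add up without
leaving the principal branch. -/
theorem Complex.mul_cpow_of_arg_add_mem {x y : ℂ} (hx : x ≠ 0) (hy : y ≠ 0)
    (h : x.arg + y.arg ∈ Ioc (-Real.pi) Real.pi) (r : ℂ) :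
    (x * y) ^ r = x ^ r * y ^ r := by
  rw [cpow_def_of_ne_zero (mul_ne_zero hx hy), cpow_def_of_ne_zero hx, cpow_def_of_ne_zero hy,
    (log_mul_eq_add_log_iff hx hy).2 h, add_mul, exp_add]

theorem integral_rpow_neg_half_mul_cexp {z : ℂ} (hz : 0 < z.im) :
    ∫ τ in Ioi (0:ℝ), ((τ ^ (-(1/2) : ℝ) : ℝ) : ℂ) * cexp (I * z * τ)
      = (Real.pi / (-I * z)) ^ ((1:ℂ)/2) := by
  have hr : 0 < (-I * z).re := by simpa using hz
  have hG := integral_gaussian_complex_Ioi hr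
  rw [← integral_comp_rpow_Ioi _ (one_half_pos (α := ℝ)).ne', eq_div_iff two_ne_zero,
    ← integral_mul_const] at hG
  rw [← hG]
  refine setIntegral_congr_fun measurableSet_Ioi fun τ hτ => ?_
  have hsq : (((τ ^ ((1:ℝ)/2) : ℝ) : ℂ)) ^ 2 = τ := by
    rw [← Real.sqrt_eq_rpow, ← ofReal_pow, Real.sq_sqrt (mem_Ioi.1 hτ).le]
  have hexp : (1:ℝ)/2 - 1 = -(1/2) := by norm_num
  simp only [hsq, hexp, real_smul, abs_of_pos (one_half_pos (α := ℝ))]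
  push_cast
  ring_nf

theorem stmt_3 (z : ℂ) (hz : 0 < z.im) :
    IntegrableOn (fun τ : ℝ => ((τ ^ (-(1/2) : ℝ) : ℝ) : ℂ) * Complex.exp (Complex.I * z * τ))
      (Ioi (0:ℝ)) volume ∧
    ((-Complex.I / (Real.pi : ℂ)) ^ ((1:ℂ)/2)) *
      ∫ τ in Ioi (0:ℝ), ((τ ^ (-(1/2) : ℝ) : ℝ) : ℂ) * Complex.exp (Complex.I * z * τ)
      = 1 / z ^ ((1:ℂ)/2) := by
  have hz0 : z ≠ 0 := by rintro rfl; simp at hz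
  have hπ0 : (Real.pi : ℂ) ≠ 0 := ofReal_ne_zero.2 Real.pi_ne_zero
  have hr : 0 < (-I * z).re := by simpa using hz
  have hr0 : -I * z ≠ 0 := mul_ne_zero (neg_ne_zero.2 I_ne_zero) hz0
  constructor
  · have hint := integrableOn_rpow_mul_exp_neg_mul_rpow (p := 1) (s := -(1/2)) (by norm_num)
      one_pos hz
    refine hint.mono' (by fun_prop) ?_
    filter_upwards [ae_restrict_mem measurableSet_Ioi] with τ hτ
    rw [mem_Ioi] at hτ
    rw [norm_mul, norm_real, norm_exp, Real.norm_of_nonneg (Real.rpow_nonneg hτ.le _)]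
    simp
  · have hx : (-I / (Real.pi : ℂ)).arg = -(Real.pi / 2) := by
      rw [show -I / (Real.pi : ℂ) = ((Real.pi⁻¹ : ℝ) : ℂ) * -I by push_cast; ring,
        arg_real_mul _ (inv_pos.2 Real.pi_pos), arg_neg_I]
    have hre : 0 < (Real.pi / (-I * z)).re := by
      rw [div_eq_mul_inv, re_ofReal_mul, inv_re]
      exact mul_pos Real.pi_pos (div_pos hr (normSq_pos.2 hr0))
    have hy := abs_lt.1 (abs_arg_lt_pi_div_two_iff.2 (Or.inl hre))
    have hxy : -I / (Real.pi : ℂ) * (Real.pi / (-I * z)) = z⁻¹ := by field_simp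
    rw [integral_rpow_neg_half_mul_cexp hz, ← mul_cpow_of_arg_add_mem
      (div_ne_zero (neg_ne_zero.2 I_ne_zero) hπ0) (div_ne_zero hπ0 hr0)
      (by rw [hx]; constructor <;> linarith [hy.1, hy.2]), hxy,
      inv_cpow _ _ (fun h => hz.ne' (arg_eq_pi_iff.1 h).2), one_div (z ^ _)]
end

section
/- Let 0 ≤ a < b be real numbers, and let C(x) = ∫₀^x cos(t²) dt and S(x) = ∫₀^x sin(t²) dt denote the Fresnel cosine and sine integrals. Then √(−i/π) · ∫_a^b τ^{−1/2} e^{iτ} · (b − τ)/(b − a) dτ = (1+i)/(√(2π)(b−a)) · [ √b e^{ib} − √a e^{ia} + (1 + 2ib)·( C(√a) − C(√b) + i·S(√a) − i·S(√b) ) ]. -/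
open Complex Real

/-- The Fresnel cosine integral `C(x) = ∫₀ˣ cos(t²) dt`. -/
noncomputable def fresnelC (x : ℝ) : ℝ := ∫ t in (0:ℝ)..x, Real.cos (t^2)

/-- The Fresnel sine integral `S(x) = ∫₀ˣ sin(t²) dt`. -/
noncomputable def fresnelS (x : ℝ) : ℝ := ∫ t in (0:ℝ)..x, Real.sin (t^2)

/-- The principal square root of `-i / π`. -/
lemma cpow_half_neg_I_div_pi :
    (-Complex.I / (Real.pi : ℂ)) ^ ((1:ℂ)/2) = (1 - Complex.I) / (Real.sqrt (2 * Real.pi) : ℂ) := by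
  have hsq : ((Real.sqrt (2 * Real.pi) : ℝ) : ℂ) ^ 2 = 2 * (Real.pi : ℂ) := by
    rw [← Complex.ofReal_pow, Real.sq_sqrt (by positivity)]
    push_cast
    rfl
  have hpi : (Real.pi : ℂ) ≠ 0 := by exact_mod_cast Real.pi_ne_zero
  have hz : ((1 - Complex.I) / (Real.sqrt (2 * Real.pi) : ℂ)) ^ 2 = -Complex.I / (Real.pi : ℂ) := by
    rw [div_pow, hsq]
    field_simp
    linear_combination Complex.I_sq
  rw [← hz, one_div]
  apply Complex.sq_cpow_two_inv
  rw [Complex.div_ofReal_re]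
  simpa using Real.pi_pos

/-- The derivative of `C + i S` is `e^{ix²}`. -/
lemma hasDerivAt_fresnelC_add_I_mul_fresnelS (x : ℝ) :
    HasDerivAt (fun y : ℝ => (fresnelC y : ℂ) + Complex.I * (fresnelS y : ℂ))
      (Complex.exp (Complex.I * ((x ^ 2 : ℝ) : ℂ))) x := by
  have hC : HasDerivAt fresnelC (Real.cos (x ^ 2)) x :=
    (by fun_prop : Continuous fun t : ℝ => Real.cos (t ^ 2)).integral_hasStrictDerivAt 0 x
      |>.hasDerivAt
  have hS : HasDerivAt fresnelS (Real.sin (x ^ 2)) x :=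
    (by fun_prop : Continuous fun t : ℝ => Real.sin (t ^ 2)).integral_hasStrictDerivAt 0 x
      |>.hasDerivAt
  refine (hC.ofReal_comp.add (hS.ofReal_comp.const_mul Complex.I)).congr_deriv ?_
  rw [mul_comm Complex.I, mul_comm Complex.I, Complex.exp_mul_I, Complex.ofReal_cos, Complex.ofReal_sin]

/-- An antiderivative of `τ^{-1/2} e^{iτ} (c - τ)` on the positive half-line. -/
noncomputable def fresnelPrimitive (c τ : ℝ) : ℂ :=
  Complex.I * ((Real.sqrt τ : ℂ) * Complex.exp (Complex.I * τ)
    - (1 + 2 * Complex.I * c) *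
      ((fresnelC (Real.sqrt τ) : ℂ) + Complex.I * (fresnelS (Real.sqrt τ) : ℂ)))

lemma continuous_fresnelPrimitive (c : ℝ) : Continuous (fresnelPrimitive c) := by
  have hE : Continuous fun y : ℝ => (fresnelC y : ℂ) + Complex.I * (fresnelS y : ℂ) :=
    continuous_iff_continuousAt.mpr fun x =>
      (hasDerivAt_fresnelC_add_I_mul_fresnelS x).continuousAt
  have hEs := hE.comp Real.continuous_sqrt
  simp only [Function.comp_def] at hEs
  unfold fresnelPrimitive
  fun_prop

lemma hasDerivAt_fresnelPrimitive (c : ℝ) {τ : ℝ} (hτ : 0 < τ) :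
    HasDerivAt (fresnelPrimitive c)
      (((τ ^ (-(1/2) : ℝ) : ℝ) : ℂ) * Complex.exp (Complex.I * τ) * ((c - τ : ℝ) : ℂ)) τ := by
  have hs : HasDerivAt Real.sqrt (1 / (2 * Real.sqrt τ)) τ := Real.hasDerivAt_sqrt hτ.ne'
  have he : HasDerivAt (fun t : ℝ => Complex.exp (Complex.I * t))
      (Complex.exp (Complex.I * τ) * (Complex.I * 1)) τ :=
    ((hasDerivAt_id τ).ofReal_comp.const_mul Complex.I).cexp
  have hE := (hasDerivAt_fresnelC_add_I_mul_fresnelS (Real.sqrt τ)).scomp τ hs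
  have h := ((hs.ofReal_comp.mul he).sub (hE.const_mul (1 + 2 * Complex.I * c))).const_mul
    Complex.I
  have hne : (Real.sqrt τ : ℂ) ≠ 0 := by exact_mod_cast (Real.sqrt_pos.mpr hτ).ne'
  have hsq : (Real.sqrt τ : ℂ) ^ 2 = (τ : ℂ) := by exact_mod_cast Real.sq_sqrt hτ.le
  have hpow : τ ^ (-(1/2) : ℝ) = (Real.sqrt τ)⁻¹ := by
    rw [Real.rpow_neg hτ.le, Real.sqrt_eq_rpow]
  refine HasDerivAt.congr_deriv h ?_
  rw [hpow, Real.sq_sqrt hτ.le, Complex.real_smul]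
  push_cast
  rw [← hsq]
  field_simp
  ring_nf
  simp only [Complex.I_sq]
  ring

lemma intervalIntegrable_rpow_neg_half_mul_exp (a b c : ℝ) :
    IntervalIntegrable (fun τ : ℝ => ((τ ^ (-(1/2) : ℝ) : ℝ) : ℂ) * Complex.exp (Complex.I * τ)
      * ((c - τ : ℝ) : ℂ)) MeasureTheory.volume a b := by
  have h : IntervalIntegrable (fun τ : ℝ => ((τ ^ (-(1/2) : ℝ) : ℝ) : ℂ))
      MeasureTheory.volume a b := by
    have h0 : IntervalIntegrable (fun τ : ℝ => τ ^ (-(1/2) : ℝ)) MeasureTheory.volume a b :=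
      intervalIntegral.intervalIntegrable_rpow' (by norm_num)
    exact ⟨h0.left.ofReal, h0.right.ofReal⟩
  exact (h.mul_continuousOn (by fun_prop)).mul_continuousOn (by fun_prop)

lemma integral_rpow_neg_half_mul_exp {a b : ℝ} (c : ℝ) (ha : 0 ≤ a) (hab : a ≤ b) :
    ∫ τ in a..b, ((τ ^ (-(1/2) : ℝ) : ℝ) : ℂ) * Complex.exp (Complex.I * τ)
      * ((c - τ : ℝ) : ℂ) = fresnelPrimitive c b - fresnelPrimitive c a :=
  intervalIntegral.integral_eq_sub_of_hasDerivAt_of_le hab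
    (continuous_fresnelPrimitive c).continuousOn
    (fun _ hτ => hasDerivAt_fresnelPrimitive c (ha.trans_lt hτ.1))
    (intervalIntegrable_rpow_neg_half_mul_exp a b c)

theorem stmt_4 (a b : ℝ) (ha : 0 ≤ a) (hab : a < b) :
    ((-Complex.I / (Real.pi : ℂ)) ^ ((1:ℂ)/2)) *
      ∫ τ in a..b, ((τ ^ (-(1/2) : ℝ) : ℝ) : ℂ) * Complex.exp (Complex.I * τ)
        * ((b - τ) / (b - a) : ℝ)
    = (1 + Complex.I) / ((Real.sqrt (2 * Real.pi) : ℂ) * ((b : ℂ) - (a : ℂ))) *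
      ((Real.sqrt b : ℂ) * Complex.exp (Complex.I * b)
        - (Real.sqrt a : ℂ) * Complex.exp (Complex.I * a)
        + (1 + 2 * Complex.I * b) *
          ((fresnelC (Real.sqrt a) : ℂ) - (fresnelC (Real.sqrt b) : ℂ)
            + Complex.I * (fresnelS (Real.sqrt a) : ℂ)
            - Complex.I * (fresnelS (Real.sqrt b) : ℂ))) := by
  have hba : (b : ℂ) - (a : ℂ) ≠ 0 := by exact_mod_cast (sub_pos.mpr hab).ne'
  have hpos : (Real.sqrt (2 * Real.pi) : ℂ) ≠ 0 := by
    exact_mod_cast (Real.sqrt_pos.mpr (by positivity : 0 < 2 * Real.pi)).ne'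
  simp only [Complex.ofReal_div, ← mul_div_assoc]
  rw [intervalIntegral.integral_div, integral_rpow_neg_half_mul_exp b ha hab.le,
    cpow_half_neg_I_div_pi, Complex.ofReal_sub]
  unfold fresnelPrimitive
  have hI : (1 - Complex.I) * Complex.I = 1 + Complex.I := by
    linear_combination -Complex.I_sq
  rw [← hI]
  field_simp
  ring
end

section
/- Let 0 ≤ a < b be real numbers, and let C(x) = ∫₀^x cos(t²) dt and S(x) = ∫₀^x sin(t²) dt denote the Fresnel cosine and sine integrals. Then √(−i/π) · ∫_a^b τ^{−1/2} e^{iτ} · (τ − a)/(b − a) dτ = (1+i)/(√(2π)(b−a)) · [ √a e^{ia} − √b e^{ib} + (1 + 2ia)·( C(√b) − C(√a) + i·S(√b) − i·S(√a) ) ]. -/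
open Complex Real

theorem hasDerivAt_fresnelC (x : ℝ) : HasDerivAt fresnelC (Real.cos (x ^ 2)) x := by
  have hc : Continuous fun t : ℝ => Real.cos (t ^ 2) := by fun_prop
  exact hc.integral_hasStrictDerivAt 0 x |>.hasDerivAt

theorem hasDerivAt_fresnelS (x : ℝ) : HasDerivAt fresnelS (Real.sin (x ^ 2)) x := by
  have hc : Continuous fun t : ℝ => Real.sin (t ^ 2) := by fun_prop
  exact hc.integral_hasStrictDerivAt 0 x |>.hasDerivAt

theorem continuous_fresnelC : Continuous fresnelC :=
  continuous_iff_continuousAt.2 fun x => (hasDerivAt_fresnelC x).continuousAt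

theorem continuous_fresnelS : Continuous fresnelS :=
  continuous_iff_continuousAt.2 fun x => (hasDerivAt_fresnelS x).continuousAt

theorem neg_I_div_pi_cpow_half :
    (-Complex.I / (Real.pi : ℂ)) ^ ((1 : ℂ) / 2) =
      (1 - Complex.I) / (Real.sqrt (2 * Real.pi) : ℂ) := by
  have hpi := Real.pi_pos
  have h1 : -Complex.I / (Real.pi : ℂ) =
      (((1 - Complex.I) / (Real.sqrt (2 * Real.pi) : ℂ)) ^ 2) := by
    have hs : ((Real.sqrt (2 * Real.pi) : ℝ) : ℂ) ^ 2 = 2 * (Real.pi : ℂ) := by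
      rw [← Complex.ofReal_pow, Real.sq_sqrt (by positivity)]
      push_cast
      rfl
    have hp : (Real.pi : ℂ) ≠ 0 := by exact_mod_cast hpi.ne'
    rw [div_pow, hs]
    field_simp
    linear_combination -Complex.I_sq
  have h2 : (1 - Complex.I) / (Real.sqrt (2 * Real.pi) : ℂ) =
      (((Real.sqrt (2 * Real.pi))⁻¹ : ℝ) : ℂ) * (1 - Complex.I) := by
    push_cast
    ring
  have harg : |((1 - Complex.I) / (Real.sqrt (2 * Real.pi) : ℂ)).arg| < Real.pi / 2 := by
    rw [Complex.abs_arg_lt_pi_div_two_iff, h2, Complex.re_ofReal_mul]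
    left
    simp
    positivity
  rw [abs_lt] at harg
  rw [h1, one_div]
  exact Complex.pow_cpow_nat_inv (n := 2) two_ne_zero (by push_cast; linarith)
    (by push_cast; linarith)

/-- An antiderivative on `(0, ∞)` of the integrand `τ ^ (-1/2) * exp (I * τ) * (τ - a)`. -/
noncomputable def oscillatoryPrimitive (a τ : ℝ) : ℂ :=
  -Complex.I * ((Real.sqrt τ : ℂ) * Complex.exp (Complex.I * τ)) +
    (Complex.I - 2 * a) *
      ((fresnelC (Real.sqrt τ) : ℂ) + Complex.I * (fresnelS (Real.sqrt τ) : ℂ))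

theorem continuous_oscillatoryPrimitive (a : ℝ) : Continuous (oscillatoryPrimitive a) := by
  have := continuous_fresnelC
  have := continuous_fresnelS
  unfold oscillatoryPrimitive
  fun_prop

theorem hasDerivAt_oscillatoryPrimitive (a : ℝ) {τ : ℝ} (hτ : 0 < τ) :
    HasDerivAt (oscillatoryPrimitive a)
      (((τ ^ (-(1/2) : ℝ) : ℝ) : ℂ) * Complex.exp (Complex.I * τ) * ((τ : ℂ) - a)) τ := by
  have hsq : HasDerivAt Real.sqrt (1 / (2 * Real.sqrt τ)) τ := Real.hasDerivAt_sqrt hτ.ne'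
  have hC := ((hasDerivAt_fresnelC (Real.sqrt τ)).comp τ hsq).ofReal_comp
  have hS := ((hasDerivAt_fresnelS (Real.sqrt τ)).comp τ hsq).ofReal_comp
  have he : HasDerivAt (fun τ : ℝ => Complex.exp (Complex.I * τ))
      (Complex.exp (Complex.I * τ) * (Complex.I * 1)) τ :=
    ((hasDerivAt_id τ).ofReal_comp.const_mul Complex.I).cexp
  have h := ((hsq.ofReal_comp.mul he).const_mul (-Complex.I)).add
    ((hC.add (hS.const_mul Complex.I)).const_mul (Complex.I - 2 * (a : ℂ)))
  refine HasDerivAt.congr_deriv h ?_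
  have hexp : Complex.exp (Complex.I * τ) = Complex.cos τ + Complex.sin τ * Complex.I := by
    rw [mul_comm, Complex.exp_mul_I]
  rw [Real.sq_sqrt hτ.le, Real.rpow_neg hτ.le, ← Real.sqrt_eq_rpow, hexp]
  push_cast
  have hs : (Real.sqrt τ : ℂ) ≠ 0 := by exact_mod_cast (Real.sqrt_pos.2 hτ).ne'
  have hs2 : (τ : ℂ) = (Real.sqrt τ : ℂ) ^ 2 := by
    rw [← Complex.ofReal_pow, Real.sq_sqrt hτ.le]
  generalize Complex.cos (τ : ℂ) = c
  generalize Complex.sin (τ : ℂ) = s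
  rw [hs2]
  field_simp
  ring_nf
  simp only [Complex.I_sq, Complex.I_pow_three]
  ring

theorem integral_rpow_neg_half_mul_exp_mul_sub {a b : ℝ} (ha : 0 ≤ a) (hab : a ≤ b) :
    ∫ τ in a..b, ((τ ^ (-(1/2) : ℝ) : ℝ) : ℂ) * Complex.exp (Complex.I * τ) * ((τ : ℂ) - a) =
      oscillatoryPrimitive a b - oscillatoryPrimitive a a := by
  refine intervalIntegral.integral_eq_sub_of_hasDerivAt_of_le hab
    (continuous_oscillatoryPrimitive a).continuousOn
    (fun τ hτ => hasDerivAt_oscillatoryPrimitive a (ha.trans_lt hτ.1)) ?_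
  have hr : IntervalIntegrable (fun τ : ℝ => ((τ ^ (-(1/2) : ℝ) : ℝ) : ℂ))
      MeasureTheory.volume a b :=
    have h := intervalIntegral.intervalIntegrable_rpow' (a := a) (b := b)
      (by norm_num : (-1 : ℝ) < -(1/2))
    ⟨h.1.ofReal, h.2.ofReal⟩
  exact (hr.mul_continuousOn (by fun_prop)).mul_continuousOn (by fun_prop)

theorem stmt_5 (a b : ℝ) (ha : 0 ≤ a) (hab : a < b) :
    ((-Complex.I / (Real.pi : ℂ)) ^ ((1:ℂ)/2)) *
      ∫ τ in a..b, ((τ ^ (-(1/2) : ℝ) : ℝ) : ℂ) * Complex.exp (Complex.I * τ)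
        * ((τ - a) / (b - a) : ℝ)
    = (1 + Complex.I) / ((Real.sqrt (2 * Real.pi) : ℂ) * ((b : ℂ) - (a : ℂ))) *
      ((Real.sqrt a : ℂ) * Complex.exp (Complex.I * a)
        - (Real.sqrt b : ℂ) * Complex.exp (Complex.I * b)
        + (1 + 2 * Complex.I * a) *
          ((fresnelC (Real.sqrt b) : ℂ) - (fresnelC (Real.sqrt a) : ℂ)
            + Complex.I * (fresnelS (Real.sqrt b) : ℂ)
            - Complex.I * (fresnelS (Real.sqrt a) : ℂ))) := by
  have hba : (b : ℂ) - a ≠ 0 := by exact_mod_cast (sub_pos.2 hab).ne'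
  have hint : (∫ τ in a..b, ((τ ^ (-(1/2) : ℝ) : ℝ) : ℂ) * Complex.exp (Complex.I * τ)
        * ((τ - a) / (b - a) : ℝ)) =
      (oscillatoryPrimitive a b - oscillatoryPrimitive a a) / ((b : ℂ) - a) := by
    rw [← integral_rpow_neg_half_mul_exp_mul_sub ha hab.le, ← intervalIntegral.integral_div]
    congr 1 with τ
    push_cast
    ring
  have hs : (Real.sqrt (2 * Real.pi) : ℂ) ≠ 0 := by
    exact_mod_cast (Real.sqrt_pos.2 Real.two_pi_pos).ne'
  rw [hint, neg_I_div_pi_cpow_half]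
  unfold oscillatoryPrimitive
  field_simp
  ring_nf
  simp only [Complex.I_sq, Complex.I_pow_three]
  ring
end

section
/- Let g : ℝ → ℂ be continuous and bounded, and define v(x) = (1/2) ∫₀^∞ e^{−τ} ( g(x + τ) + g(x − τ) ) dτ. Then v is twice continuously differentiable on ℝ and satisfies v(x) − v''(x) = g(x) for all x ∈ ℝ. -/
open MeasureTheory Set

theorem integrableOn_exp_neg_mul_of_bounded {g : ℝ → ℂ} (hg : Continuous g) {C : ℝ}
    (hC : ∀ x, ‖g x‖ ≤ C) (c : ℝ) :
    IntegrableOn (fun τ : ℝ => (Real.exp (-τ) : ℂ) * g τ) (Ioi c) :=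
  Integrable.mul_bdd (integrableOn_exp_neg_Ioi c).ofReal hg.aestronglyMeasurable
    (Filter.Eventually.of_forall hC)

theorem integral_exp_neg_mul_comp_add_left (g : ℝ → ℂ) (x : ℝ) :
    ∫ τ in Ioi (0 : ℝ), (Real.exp (-τ) : ℂ) * g (x + τ) =
      (Real.exp x : ℂ) * ∫ s in Ioi x, (Real.exp (-s) : ℂ) * g s := by
  have h := (measurePreserving_add_left volume x).setIntegral_preimage_emb
    (measurableEmbedding_addLeft x) (fun s => (Real.exp (-s) : ℂ) * g s) (Ioi x)
  rw [← h, ← integral_const_mul, preimage_const_add_Ioi, sub_self]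
  congr 1 with τ
  rw [← mul_assoc, ← Complex.ofReal_mul, ← Real.exp_add]
  ring_nf

theorem hasDerivAt_integral_exp_neg_mul_comp_add_left {g : ℝ → ℂ} (hg : Continuous g) {C : ℝ}
    (hC : ∀ x, ‖g x‖ ≤ C) (x : ℝ) :
    HasDerivAt (fun y : ℝ => ∫ τ in Ioi (0 : ℝ), (Real.exp (-τ) : ℂ) * g (y + τ))
      ((∫ τ in Ioi (0 : ℝ), (Real.exp (-τ) : ℂ) * g (x + τ)) - g x) x := by
  simp only [integral_exp_neg_mul_comp_add_left]
  have hcont : Continuous fun s : ℝ => (Real.exp (-s) : ℂ) * g s := by fun_prop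
  have hint := integrableOn_exp_neg_mul_of_bounded hg hC
  have htail : HasDerivAt (fun y : ℝ => ∫ s in Ioi y, (Real.exp (-s) : ℂ) * g s)
      (-((Real.exp (-x) : ℂ) * g x)) x := by
    have hsplit : (fun y : ℝ => ∫ s in Ioi y, (Real.exp (-s) : ℂ) * g s) = fun y =>
        (∫ s in Ioi (0 : ℝ), (Real.exp (-s) : ℂ) * g s) -
          ∫ s in (0 : ℝ)..y, (Real.exp (-s) : ℂ) * g s := by
      funext y
      rw [← intervalIntegral.integral_Ioi_sub_Ioi' (hint 0) (hint y), sub_sub_cancel]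
    rw [hsplit]
    exact (hcont.integral_hasStrictDerivAt 0 x).hasDerivAt.const_sub _
  refine ((Real.hasDerivAt_exp x).ofReal_comp.mul htail).congr_deriv ?_
  rw [mul_neg, ← mul_assoc, ← Complex.ofReal_mul, ← Real.exp_add, add_neg_cancel, Real.exp_zero,
    Complex.ofReal_one, one_mul, sub_eq_add_neg]

theorem hasDerivAt_integral_exp_neg_mul_comp_sub_left {g : ℝ → ℂ} (hg : Continuous g) {C : ℝ}
    (hC : ∀ x, ‖g x‖ ≤ C) (x : ℝ) :
    HasDerivAt (fun y : ℝ => ∫ τ in Ioi (0 : ℝ), (Real.exp (-τ) : ℂ) * g (y - τ))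
      (g x - ∫ τ in Ioi (0 : ℝ), (Real.exp (-τ) : ℂ) * g (x - τ)) x := by
  have h := (hasDerivAt_integral_exp_neg_mul_comp_add_left (g := fun y => g (-y))
    (by fun_prop) (fun y => hC (-y)) (-x)).scomp x (hasDerivAt_neg x)
  simpa [Function.comp_def, ← sub_eq_add_neg, add_comm] using h

theorem stmt_6 (g : ℝ → ℂ) (hg : Continuous g) (hb : ∃ C : ℝ, ∀ x : ℝ, ‖g x‖ ≤ C)
    (v : ℝ → ℂ)
    (hv : v = fun x : ℝ =>
      (1/2 : ℂ) * ∫ τ in Ioi (0:ℝ), ((Real.exp (-τ)) : ℂ) * (g (x + τ) + g (x - τ))) :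
    ContDiff ℝ 2 v ∧ ∀ x : ℝ, v x - deriv (deriv v) x = g x := by
  obtain ⟨C, hC⟩ := hb
  have hA := hasDerivAt_integral_exp_neg_mul_comp_add_left hg hC
  have hB := hasDerivAt_integral_exp_neg_mul_comp_sub_left hg hC
  set A : ℝ → ℂ := fun y => ∫ τ in Ioi (0 : ℝ), (Real.exp (-τ) : ℂ) * g (y + τ) with hAdef
  set B : ℝ → ℂ := fun y => ∫ τ in Ioi (0 : ℝ), (Real.exp (-τ) : ℂ) * g (y - τ) with hBdef
  have hvAB : v = fun x => (1 / 2 : ℂ) * (A x + B x) := by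
    rw [hv]
    funext x
    simp only [hAdef, hBdef, mul_add]
    rw [integral_add
      (integrableOn_exp_neg_mul_of_bounded (g := fun τ => g (x + τ)) (by fun_prop)
        (fun τ => hC _) 0)
      (integrableOn_exp_neg_mul_of_bounded (g := fun τ => g (x - τ)) (by fun_prop)
        (fun τ => hC _) 0), mul_add]
  have hv1 (x : ℝ) : HasDerivAt v ((1 / 2 : ℂ) * (A x - B x)) x := by
    rw [hvAB]
    refine (((hA x).add (hB x)).const_mul (1 / 2 : ℂ)).congr_deriv ?_
    ring
  have hdv : deriv v = fun x => (1 / 2 : ℂ) * (A x - B x) := funext fun x => (hv1 x).deriv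
  have hv2 (x : ℝ) : HasDerivAt (deriv v) (v x - g x) x := by
    rw [hdv, hvAB]
    refine (((hA x).sub (hB x)).const_mul (1 / 2 : ℂ)).congr_deriv ?_
    ring
  have hddv : deriv (deriv v) = fun x => v x - g x := funext fun x => (hv2 x).deriv
  have hvd : Differentiable ℝ v := fun x => (hv1 x).differentiableAt
  refine ⟨?_, fun x => by rw [hddv, sub_sub_cancel]⟩
  rw [show (2 : WithTop ℕ∞) = 1 + 1 by norm_num, contDiff_succ_iff_deriv, contDiff_one_iff_deriv]
  refine ⟨hvd, by simp, fun x => (hv2 x).differentiableAt, ?_⟩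
  rw [hddv]
  exact hvd.continuous.sub hg
end

section
/- Let c > 0 and b > 1. Then the series ∑_{n=1}^∞ e^{−c(bⁿ − 1)} · b^{3(n−1)} · (bⁿ − 1)^{−1/2} converges and its sum is at most (√π / (4 c^{5/2} log b)) · (3 + 4c(1 + c)). -/
open MeasureTheory Set

/-- Integrability of the Gamma-type integrand `t ^ (a - 1) * exp (-(r * t))` on the half-line. -/
lemma integrableOn_rpow_sub_one_mul_exp_neg_mul {a r : ℝ} (ha : 0 < a) (hr : 0 < r) :
    IntegrableOn (fun t : ℝ => t ^ (a - 1) * Real.exp (-(r * t))) (Ioi 0) := by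
  refine Integrable.of_integral_ne_zero ?_
  rw [Real.integral_rpow_mul_exp_neg_mul_Ioi ha hr]
  have := Real.Gamma_pos_of_pos ha
  positivity

lemma exp_mul_sq_mul_rpow_eq (c : ℝ) {u : ℝ} (hu : 0 < u) :
    Real.exp (-c * u) * (1 + u) ^ 2 * u ^ (-(1/2) : ℝ)
      = u ^ ((1/2 : ℝ) - 1) * Real.exp (-(c * u))
        + 2 * (u ^ ((3/2 : ℝ) - 1) * Real.exp (-(c * u)))
        + u ^ ((5/2 : ℝ) - 1) * Real.exp (-(c * u)) := by
  have h1 : u ^ ((3/2 : ℝ) - 1) = u * u ^ (-(1/2) : ℝ) := by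
    rw [← Real.rpow_one_add' hu.le (by norm_num)]; norm_num
  have h2 : u ^ ((5/2 : ℝ) - 1) = u ^ 2 * u ^ (-(1/2) : ℝ) := by
    rw [← Real.rpow_natCast u 2, ← Real.rpow_add hu]; norm_num
  have h0 : (1/2 : ℝ) - 1 = -(1/2) := by norm_num
  rw [h1, h2, h0, neg_mul]
  ring

lemma integrableOn_exp_mul_sq_mul_rpow {c : ℝ} (hc : 0 < c) :
    IntegrableOn (fun u : ℝ => Real.exp (-c * u) * (1 + u) ^ 2 * u ^ (-(1/2) : ℝ)) (Ioi 0) := by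
  refine IntegrableOn.congr_fun ?_ (fun u hu => (exp_mul_sq_mul_rpow_eq c hu).symm)
    measurableSet_Ioi
  exact ((integrableOn_rpow_sub_one_mul_exp_neg_mul (by norm_num) hc).add
    ((integrableOn_rpow_sub_one_mul_exp_neg_mul (by norm_num) hc).const_mul 2)).add
    (integrableOn_rpow_sub_one_mul_exp_neg_mul (by norm_num) hc)

lemma integral_exp_mul_sq_mul_rpow {c : ℝ} (hc : 0 < c) :
    ∫ u in Ioi (0 : ℝ), Real.exp (-c * u) * (1 + u) ^ 2 * u ^ (-(1/2) : ℝ)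
      = Real.sqrt Real.pi / (4 * c ^ ((5:ℝ)/2)) * (3 + 4 * c * (1 + c)) := by
  have i1 := integrableOn_rpow_sub_one_mul_exp_neg_mul (a := 1/2) (by norm_num) hc
  have i2 := (integrableOn_rpow_sub_one_mul_exp_neg_mul (a := 3/2) (by norm_num) hc).const_mul 2
  have i3 := integrableOn_rpow_sub_one_mul_exp_neg_mul (a := 5/2) (by norm_num) hc
  have i12 : IntegrableOn (fun u : ℝ => u ^ ((1/2 : ℝ) - 1) * Real.exp (-(c * u))
      + 2 * (u ^ ((3/2 : ℝ) - 1) * Real.exp (-(c * u)))) (Ioi 0) := i1.add i2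
  rw [setIntegral_congr_fun measurableSet_Ioi (fun u hu => exp_mul_sq_mul_rpow_eq c hu),
    integral_add i12 i3, integral_add i1 i2, integral_const_mul,
    Real.integral_rpow_mul_exp_neg_mul_Ioi (by norm_num) hc,
    Real.integral_rpow_mul_exp_neg_mul_Ioi (by norm_num) hc,
    Real.integral_rpow_mul_exp_neg_mul_Ioi (by norm_num) hc]
  have g3 : Real.Gamma (3/2) = 1/2 * Real.sqrt Real.pi := by
    rw [← Real.Gamma_one_half_eq, ← Real.Gamma_add_one (by norm_num)]; norm_num
  have g5 : Real.Gamma (5/2) = 3/4 * Real.sqrt Real.pi := by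
    have : (5/2 : ℝ) = 3/2 + 1 := by norm_num
    rw [this, Real.Gamma_add_one (by norm_num), g3]; ring
  have p3 : c ^ (3/2 : ℝ) = c * c ^ (1/2 : ℝ) := by
    rw [← Real.rpow_one_add' hc.le (by norm_num)]; norm_num
  have p5 : c ^ (5/2 : ℝ) = c ^ 2 * c ^ (1/2 : ℝ) := by
    rw [← Real.rpow_natCast c 2, ← Real.rpow_add hc]; norm_num
  have hpos : 0 < c ^ (1/2 : ℝ) := by positivity
  simp only [one_div c, Real.inv_rpow hc.le]
  rw [Real.Gamma_one_half_eq, g3, g5, p3, p5]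
  field_simp
  ring

lemma pow_mul_log_le_integral {c b : ℝ} (hc : 0 < c) (hb : 1 < b) (n : ℕ) :
    Real.exp (-c * (b ^ (n + 1) - 1)) * b ^ (3 * n) * (b ^ (n + 1) - 1) ^ (-(1/2) : ℝ)
        * Real.log b
      ≤ ∫ u in (b ^ n - 1)..(b ^ (n + 1) - 1),
          Real.exp (-c * u) * (1 + u) ^ 2 * u ^ (-(1/2) : ℝ) := by
  have hb0 : 0 < b := by linarith
  have hn : 1 ≤ b ^ n := one_le_pow₀ hb.le
  have hlt : b ^ n < b ^ (n + 1) := pow_lt_pow_right₀ hb n.lt_succ_self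
  have hle : b ^ n - 1 ≤ b ^ (n + 1) - 1 := by linarith
  have hinv : ∫ u in (b ^ n - 1)..(b ^ (n + 1) - 1), (1 + u)⁻¹ = Real.log b := by
    rw [intervalIntegral.integral_comp_add_left (fun u : ℝ => u⁻¹),
      integral_inv_of_pos (by linarith) (by linarith)]
    congr 1
    have := pow_pos hb0 n
    rw [add_sub_cancel, add_sub_cancel, pow_succ]
    field_simp
  rw [← hinv, ← intervalIntegral.integral_const_mul]
  refine intervalIntegral.integral_mono_on_of_le_Ioo hle ?_ ?_ fun u hu => ?_
  · refine ContinuousOn.intervalIntegrable fun u hu => ContinuousAt.continuousWithinAt ?_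
    rw [uIcc_of_le hle] at hu
    have : 1 + u ≠ 0 := by linarith [hu.1]
    fun_prop (disch := assumption)
  · rw [intervalIntegrable_iff_integrableOn_Ioc_of_le hle]
    exact (integrableOn_exp_mul_sq_mul_rpow hc).mono_set
      fun u hu => lt_of_le_of_lt (by linarith) hu.1
  · obtain ⟨h1, h2⟩ := hu
    have hu0 : 0 < u := by linarith
    have he : Real.exp (-c * (b ^ (n + 1) - 1)) ≤ Real.exp (-c * u) :=
      Real.exp_le_exp.2 (by nlinarith)
    have hr : (b ^ (n + 1) - 1) ^ (-(1/2) : ℝ) ≤ u ^ (-(1/2) : ℝ) :=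
      Real.rpow_le_rpow_of_nonpos hu0 h2.le (by norm_num)
    have hp : b ^ (3 * n) * (1 + u)⁻¹ ≤ (1 + u) ^ 2 := by
      rw [← div_eq_mul_inv, div_le_iff₀ (by linarith), mul_comm 3, pow_mul, ← pow_succ]
      exact pow_le_pow_left₀ (by positivity) (by linarith) 3
    have hz : 0 ≤ (b ^ (n + 1) - 1) ^ (-(1/2) : ℝ) := Real.rpow_nonneg (by linarith) _
    calc _ = Real.exp (-c * (b ^ (n + 1) - 1)) * (b ^ (3 * n) * (1 + u)⁻¹)
          * (b ^ (n + 1) - 1) ^ (-(1/2) : ℝ) := by ring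
      _ ≤ _ := by gcongr

theorem stmt_10 (c b : ℝ) (hc : 0 < c) (hb : 1 < b) :
    Summable (fun n : ℕ =>
      Real.exp (-c * (b ^ (n + 1 : ℕ) - 1)) * b ^ (3 * n : ℕ)
        * (b ^ (n + 1 : ℕ) - 1) ^ (-(1/2) : ℝ)) ∧
    ∑' n : ℕ, Real.exp (-c * (b ^ (n + 1 : ℕ) - 1)) * b ^ (3 * n : ℕ)
        * (b ^ (n + 1 : ℕ) - 1) ^ (-(1/2) : ℝ)
      ≤ (Real.sqrt Real.pi / (4 * c ^ ((5:ℝ)/2) * Real.log b)) * (3 + 4 * c * (1 + c)) := by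
  have hb0 : 0 < b := by linarith
  have hlog : 0 < Real.log b := Real.log_pos hb
  have hone (n : ℕ) : 1 ≤ b ^ n := one_le_pow₀ hb.le
  have hnonneg (n : ℕ) : 0 ≤ Real.exp (-c * (b ^ (n + 1 : ℕ) - 1)) * b ^ (3 * n : ℕ)
      * (b ^ (n + 1 : ℕ) - 1) ^ (-(1/2) : ℝ) :=
    mul_nonneg (by positivity) (Real.rpow_nonneg (by linarith [hone (n + 1)]) _)
  have hint := integrableOn_exp_mul_sq_mul_rpow hc
  have hbound (N : ℕ) : ∑ n ∈ Finset.range N, Real.exp (-c * (b ^ (n + 1 : ℕ) - 1))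
      * b ^ (3 * n : ℕ) * (b ^ (n + 1 : ℕ) - 1) ^ (-(1/2) : ℝ)
      ≤ (Real.sqrt Real.pi / (4 * c ^ ((5:ℝ)/2) * Real.log b)) * (3 + 4 * c * (1 + c)) := by
    have hrhs : (Real.sqrt Real.pi / (4 * c ^ ((5:ℝ)/2) * Real.log b)) * (3 + 4 * c * (1 + c))
        = (∫ u in Ioi (0 : ℝ), Real.exp (-c * u) * (1 + u) ^ 2 * u ^ (-(1/2) : ℝ))
          / Real.log b := by
      rw [integral_exp_mul_sq_mul_rpow hc]
      field_simp
    rw [hrhs, le_div_iff₀ hlog, Finset.sum_mul]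
    refine (Finset.sum_le_sum fun n _ => pow_mul_log_le_integral hc hb n).trans ?_
    rw [intervalIntegral.sum_integral_adjacent_intervals (a := fun n : ℕ => b ^ n - 1)
      fun n _ => ?_]
    · have hsub : Ioc (b ^ 0 - 1) (b ^ N - 1) ⊆ Ioi 0 := by
        simpa using (Ioc_subset_Ioi_self : Ioc 0 (b ^ N - 1) ⊆ Ioi 0)
      rw [intervalIntegral.integral_of_le (by simpa using hone N)]
      refine setIntegral_mono_set hint ?_ (Filter.Eventually.of_forall hsub)
      filter_upwards [ae_restrict_mem measurableSet_Ioi] with u hu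
      have : 0 < u := hu
      positivity
    · rw [intervalIntegrable_iff_integrableOn_Ioc_of_le
        (sub_le_sub_right (pow_le_pow_right₀ hb.le n.le_succ) 1)]
      exact hint.mono_set fun u hu => lt_of_le_of_lt (by linarith [hone n]) hu.1
  exact ⟨summable_of_sum_range_le hnonneg hbound, Real.tsum_le_of_sum_range_le hnonneg hbound⟩
end
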